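/- arXiv:1707.05040 — 3 statements merged into one kernel-verified Lean document; each statement's English description precedes it below -/
import Mathlib

section
/- Let C be an abelian category with enough projectives in which every projective has injective dimension at most d. Then every object admitting a projective coresolution (an exact sequence 0→X→Q⁰→Q¹→⋯ with all Q^i projective) is Gorenstein projective; conversely every Gorenstein projective object admits a projective coresolution. Hence gpC equals the class of objects admitting a projective coresolution. -/
open CategoryTheory CategoryTheory.Limits

universe w w' v v' u u'

section Defs

variable {C : Type u} [Category.{v} C] [Abelian C]

/-- `f`, `g` form a short exact sequence `0 → X → Y → Z → 0`. -/
def IsSES {X Y Z : C} (f : X ⟶ Y) (g : Y ⟶ Z) : Prop :=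
  ∃ w : f ≫ g = 0, (ShortComplex.mk f g w).ShortExact

/-- Vanishing of the Yoneda Ext¹ group: every short exact sequence
`0 → P → E → Z → 0` splits. -/
def YonedaExt1Zero (Z P : C) : Prop :=
  ∀ (E : C) (i : P ⟶ E) (p : E ⟶ Z), IsSES i p → ∃ s : Z ⟶ E, s ≫ p = 𝟙 Z

/-- A totally acyclic complex of projectives: an exact complex of projective
objects which stays exact after applying `Hom(-, Q)` for every projective `Q`. -/
structure IsTotallyAcyclic (P : ChainComplex C ℤ) : Prop where
  projective : ∀ i, Projective (P.X i)
  acyclic : ∀ i, P.ExactAt i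
  homExact : ∀ (Q : C), Projective Q → ∀ (i : ℤ) (f : P.X i ⟶ Q),
    P.d (i + 1) i ≫ f = 0 → ∃ g : P.X (i - 1) ⟶ Q, P.d i (i - 1) ≫ g = f

/-- An object is Gorenstein projective if it is (isomorphic to) a syzygy of a
totally acyclic complex of projectives. -/
def IsGorensteinProjective (X : C) : Prop :=
  ∃ P : ChainComplex C ℤ, IsTotallyAcyclic P ∧ Nonempty (X ≅ cokernel (P.d 1 0))

/-- `X` admits a resolution of length at most `n` by objects satisfying `S`. -/
inductive HasResDimLE (S : C → Prop) : C → ℕ → Prop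
  | of_mem {X : C} (hX : S X) (n : ℕ) : HasResDimLE S X n
  | step {X K G : C} (n : ℕ) (f : K ⟶ G) (g : G ⟶ X)
      (hses : IsSES f g) (hG : S G) (hK : HasResDimLE S K n) :
      HasResDimLE S X (n + 1)

/-- The G-dimension: the minimal length of a Gorenstein projective resolution. -/
noncomputable def gDim (X : C) : ℕ∞ :=
  sInf {n : ℕ∞ | ∃ m : ℕ, n = (m : ℕ∞) ∧ HasResDimLE IsGorensteinProjective X m}

variable [HasExt.{w} C]

/-- The projective dimension: the minimal `m` such that `Ext^j(X, -)` vanishes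
for all `j > m`. -/
noncomputable def projDim (X : C) : ℕ∞ :=
  sInf {n : ℕ∞ | ∃ m : ℕ, n = (m : ℕ∞) ∧
    ∀ (Y : C) (j : ℕ), m < j → Subsingleton (Abelian.Ext X Y j)}

/-- The injective dimension: the minimal `m` such that `Ext^j(-, X)` vanishes
for all `j > m`. -/
noncomputable def injDim (X : C) : ℕ∞ :=
  sInf {n : ℕ∞ | ∃ m : ℕ, n = (m : ℕ∞) ∧
    ∀ (Y : C) (j : ℕ), m < j → Subsingleton (Abelian.Ext Y X j)}

end Defs

section Opcycles

variable {C : Type u} [Category.{v} C] [Abelian C]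

/-- If `K` is exact in degree `i`, then the opcycles in degree `i` embed into the next term,
and the quotient consists of the opcycles there. -/
lemma HomologicalComplex.ExactAt.shortExact_fromOpcycles {ι : Type*} {c : ComplexShape ι}
    {K : HomologicalComplex C c} {i : ι} (hK : K.ExactAt i) {j : ι} (hij : c.Rel i j) :
    (ShortComplex.mk (K.fromOpcycles i j) (K.pOpcycles j) (by
      rw [← cancel_epi (K.pOpcycles i), K.p_fromOpcycles_assoc, K.d_pOpcycles,
        comp_zero])).ShortExact where
  exact := by
    let S := ShortComplex.mk (K.d i j) (K.pOpcycles j) (K.d_pOpcycles i j)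
    have hS : S.Exact :=
      ShortComplex.exact_of_g_is_cokernel _ (K.opcyclesIsCokernel i j (c.prev_eq' hij))
    let φ : S ⟶ ShortComplex.mk (K.fromOpcycles i j) (K.pOpcycles j) (by
        rw [← cancel_epi (K.pOpcycles i), K.p_fromOpcycles_assoc, K.d_pOpcycles, comp_zero]) :=
      { τ₁ := K.pOpcycles i
        τ₂ := 𝟙 _
        τ₃ := 𝟙 _ }
    have : Epi φ.τ₁ := inferInstanceAs (Epi (K.pOpcycles i))
    have : IsIso φ.τ₂ := inferInstanceAs (IsIso (𝟙 _))
    have : Mono φ.τ₃ := inferInstanceAs (Mono (𝟙 _))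
    exact (ShortComplex.exact_iff_of_epi_of_isIso_of_mono φ).1 hS
  mono_f := Preadditive.mono_of_isZero_kernel' _ (K.homologyIsKernel i j (c.next_eq' hij))
    hK.isZero_homology
  epi_g := inferInstanceAs (Epi (K.pOpcycles j))

end Opcycles

section TotallyAcyclic

variable {C : Type u} [Category.{v} C] [Abelian C] [HasExt.{w} C]

/-- Dimension shifting along a short exact sequence with projective middle term. -/
lemma CategoryTheory.ShortComplex.ShortExact.subsingleton_ext_of_projective
    {S : ShortComplex C} (hS : S.ShortExact) [Projective S.X₂] {R : C} (n : ℕ)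
    [Subsingleton (Abelian.Ext S.X₃ R (n + 2))] :
    Subsingleton (Abelian.Ext S.X₁ R (n + 1)) := by
  refine subsingleton_of_forall_eq 0 fun x => ?_
  obtain ⟨y, rfl⟩ := Abelian.Ext.contravariant_sequence_exact₁ hS R x
    (show 1 + (n + 1) = n + 2 by omega) (Subsingleton.elim _ _)
  rw [y.eq_zero_of_projective, Abelian.Ext.comp_zero]

variable {P : ChainComplex C ℤ} (hproj : ∀ i, Projective (P.X i)) (hP : ∀ i, P.ExactAt i)
  {R : C} {d : ℕ} (hR : ∀ (Y : C) (j : ℕ), d < j → Subsingleton (Abelian.Ext Y R j))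

include hproj hP hR

/-- The syzygies of an exact complex of projectives have no higher extensions by objects of
finite injective dimension. -/
lemma subsingleton_ext_opcycles (n : ℕ) (i : ℤ) :
    Subsingleton (Abelian.Ext (P.opcycles i) R (n + 1)) := by
  suffices ∀ (k n : ℕ), d < n + 1 + k → ∀ i : ℤ,
      Subsingleton (Abelian.Ext (P.opcycles i) R (n + 1)) from this d n (by omega) i
  intro k
  induction k with
  | zero => exact fun n hn i => hR _ _ hn
  | succ k ih =>
    intro n hn i
    have := ih (n + 1) (by omega) (i - 1)
    have := hproj (i - 1)
    exact ((hP i).shortExact_fromOpcycles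
      (show (ComplexShape.down ℤ).Rel i (i - 1) by simp)).subsingleton_ext_of_projective n

lemma exists_extension_of_exactAt (i : ℤ) (f : P.X i ⟶ R) (hf : P.d (i + 1) i ≫ f = 0) :
    ∃ g : P.X (i - 1) ⟶ R, P.d i (i - 1) ≫ g = f := by
  have hS := (hP i).shortExact_fromOpcycles
    (show (ComplexShape.down ℤ).Rel i (i - 1) by simp)
  have := subsingleton_ext_opcycles hproj hP hR 0 (i - 1)
  obtain ⟨y, hy⟩ := Abelian.Ext.contravariant_sequence_exact₁ hS R
    (Abelian.Ext.mk₀ (P.descOpcycles f (i + 1) (by simp) hf)) (show 1 + 0 = 0 + 1 from rfl)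
    (Subsingleton.elim _ _)
  obtain ⟨g, rfl⟩ := (Abelian.Ext.mk₀_bijective _ _).2 y
  rw [Abelian.Ext.mk₀_comp_mk₀] at hy
  refine ⟨g, ?_⟩
  rw [← P.p_fromOpcycles, Category.assoc, (Abelian.Ext.mk₀_bijective _ _).1 hy,
    P.p_descOpcycles]

end TotallyAcyclic

section Connect

variable {C : Type u} [Category.{v} C] [Abelian C]
  {K : ChainComplex C ℕ} {L : CochainComplex C ℕ}

/-- Splicing two exact sequences `⋯ → K₁ → K₀ → X → 0` and `0 → X → L⁰ → L¹ → ⋯` yields an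
acyclic complex. -/
lemma CochainComplex.ConnectData.acyclic_cochainComplex (h : CochainComplex.ConnectData K L)
    {X : C} {p : K.X 0 ⟶ X} {ι : X ⟶ L.X 0} (hd : p ≫ ι = h.d₀) [Epi p] [Mono ι]
    {wK : K.d 1 0 ≫ p = 0} {wL : ι ≫ L.d 0 1 = 0}
    (hp : (ShortComplex.mk _ _ wK).Exact) (hι : (ShortComplex.mk _ _ wL).Exact)
    (hK : ∀ n : ℕ, K.ExactAt (n + 1)) (hL : ∀ n : ℕ, L.ExactAt (n + 1)) :
    h.cochainComplex.Acyclic := by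
  rintro ((_ | n) | (_ | n))
  · refine (h.cochainComplex.exactAt_iff' (-1) 0 1 (by simp) (by simp)).2 ?_
    let φ : ShortComplex.mk _ _ h.d₀_comp ⟶ ShortComplex.mk _ _ wL :=
      { τ₁ := p
        τ₂ := 𝟙 _
        τ₃ := 𝟙 _ }
    have : Epi φ.τ₁ := inferInstanceAs (Epi p)
    have : IsIso φ.τ₂ := inferInstanceAs (IsIso (𝟙 _))
    have : Mono φ.τ₃ := inferInstanceAs (Mono (𝟙 _))
    exact (ShortComplex.exact_iff_of_epi_of_isIso_of_mono φ).2 hι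
  · rw [HomologicalComplex.exactAt_iff_isZero_homology]
    exact (hL n).isZero_homology.of_iso (h.homologyIsoPos (n + 1) _ rfl)
  · refine (h.cochainComplex.exactAt_iff' (-2) (-1) 0 (by simp) (by simp)).2 ?_
    let φ : ShortComplex.mk _ _ wK ⟶ ShortComplex.mk _ _ h.comp_d₀ :=
      { τ₁ := 𝟙 _
        τ₂ := 𝟙 _
        τ₃ := ι }
    have : Epi φ.τ₁ := inferInstanceAs (Epi (𝟙 _))
    have : IsIso φ.τ₂ := inferInstanceAs (IsIso (𝟙 _))
    have : Mono φ.τ₃ := inferInstanceAs (Mono ι)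
    exact (ShortComplex.exact_iff_of_epi_of_isIso_of_mono φ).1 hp
  · rw [HomologicalComplex.exactAt_iff_isZero_homology]
    exact (hK n).isZero_homology.of_iso (h.homologyIsoNeg (n + 1) _ rfl)

end Connect

/-- The reindexing `i ↦ -1 - i` of homologically graded complexes as cohomologically graded
ones. -/
@[simps]
def embeddingDownIntUpInt : (ComplexShape.down ℤ).Embedding (ComplexShape.up ℤ) where
  f i := -1 - i
  injective_f _ _ h := by simpa using h
  rel h := by
    simp only [ComplexShape.down_Rel, ComplexShape.up_Rel] at h ⊢
    omega

instance : embeddingDownIntUpInt.IsRelIff where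
  rel' i j h := by
    simp only [embeddingDownIntUpInt_f, ComplexShape.up_Rel, ComplexShape.down_Rel] at h ⊢
    omega

/-- The embedding `i ↦ -1 - i` of the natural numbers as the negative integers. -/
@[simps]
def embeddingUpNatDownInt : (ComplexShape.up ℕ).Embedding (ComplexShape.down ℤ) where
  f i := Int.negSucc i
  injective_f _ _ h := Int.negSucc.inj h
  rel h := by
    simp only [ComplexShape.down_Rel, ComplexShape.up_Rel] at h ⊢
    omega

instance : embeddingUpNatDownInt.IsRelIff where
  rel' i j h := by
    simp only [embeddingUpNatDownInt_f, ComplexShape.up_Rel, ComplexShape.down_Rel] at h ⊢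
    omega

section Coresolution

variable {C : Type u} [Category.{v} C] [Abelian C]

/-- `X` admits a coresolution `0 → X → Q⁰ → Q¹ → ⋯` by projective objects. -/
def HasProjectiveCoresolution (X : C) : Prop :=
  ∃ (Q : CochainComplex C ℕ) (ι : X ⟶ Q.X 0) (w : ι ≫ Q.d 0 1 = 0),
    (∀ i, Projective (Q.X i)) ∧ Mono ι ∧
    (ShortComplex.mk ι (Q.d 0 1) w).Exact ∧
    ∀ i : ℕ, Q.ExactAt (i + 1)

lemma IsGorensteinProjective.hasProjectiveCoresolution {X : C}
    (hX : IsGorensteinProjective X) : HasProjectiveCoresolution X := by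
  obtain ⟨P, hP, ⟨e⟩⟩ := hX
  let e' : X ≅ P.opcycles 0 := e ≪≫ (cokernelIsCokernel (P.d 1 0)).coconePointUniqueUpToIso
    (P.opcyclesIsCokernel 1 0 (by simp))
  have h₀ := (hP.acyclic 0).shortExact_fromOpcycles
    (show (ComplexShape.down ℤ).Rel 0 (-1) by simp)
  have := h₀.mono_f
  let ι : X ⟶ P.X (-1) := e'.hom ≫ P.fromOpcycles 0 (-1)
  have : Mono ι := mono_comp _ _
  have w : ι ≫ P.d (-1) (-2) = 0 := by simp [ι]
  refine ⟨P.restriction embeddingUpNatDownInt, by exact ι, w,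
    fun i => hP.projective _, this, ?_, fun i => ?_⟩
  · let S := ShortComplex.mk (P.d 0 (-1)) (P.d (-1) (-2)) (P.d_comp_d _ _ _)
    have hS : S.Exact :=
      (P.exactAt_iff' 0 (-1) (-2) (by simp) (by simp)).1 (hP.acyclic (-1))
    let φ : S ⟶ ShortComplex.mk _ _ w :=
      { τ₁ := P.pOpcycles 0 ≫ e'.inv
        τ₂ := 𝟙 _
        τ₃ := 𝟙 _ }
    have : Epi φ.τ₁ := inferInstanceAs (Epi (P.pOpcycles 0 ≫ e'.inv))
    have : IsIso φ.τ₂ := inferInstanceAs (IsIso (𝟙 _))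
    have : Mono φ.τ₃ := inferInstanceAs (Mono (𝟙 _))
    exact (ShortComplex.exact_iff_of_epi_of_isIso_of_mono φ).1 hS
  · refine (HomologicalComplex.exactAt_iff' _ i (i + 1) (i + 2) (by simp) (by simp)).2 ?_
    exact (P.exactAt_iff' _ _ _ (by simp; omega) (by simp)).1 (hP.acyclic _)

lemma HasProjectiveCoresolution.exists_acyclic [EnoughProjectives C] {X : C}
    (hX : HasProjectiveCoresolution X) :
    ∃ P : ChainComplex C ℤ, (∀ i, Projective (P.X i)) ∧ (∀ i, P.ExactAt i) ∧
      Nonempty (X ≅ cokernel (P.d 1 0)) := by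
  obtain ⟨Q, ι, w, hQ, hmono, hι, hexact⟩ := hX
  let R := projectiveResolution X
  let p : R.complex.X 0 ⟶ X := R.π.f 0
  have : Epi p := inferInstanceAs (Epi (R.π.f 0))
  have hp : R.complex.d 1 0 ≫ p = 0 := R.complex_d_comp_π_f_zero
  let h : CochainComplex.ConnectData R.complex Q :=
    { d₀ := p ≫ ι
      comp_d₀ := by rw [← Category.assoc, hp, zero_comp]
      d₀_comp := by rw [Category.assoc, w, comp_zero] }
  have hac : h.cochainComplex.Acyclic := h.acyclic_cochainComplex rfl (wK := hp)
    R.exact₀ hι R.complex_exactAt_succ hexact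
  have hproj : ∀ i, Projective (h.cochainComplex.X i) := by
    rintro (n | n)
    · exact hQ n
    · exact R.projective n
  refine ⟨h.cochainComplex.restriction embeddingDownIntUpInt, fun i => hproj _, fun i => ?_, ⟨?_⟩⟩
  · refine (HomologicalComplex.exactAt_iff' _ (i + 1) i (i - 1) (by simp) (by simp)).2 ?_
    exact (h.cochainComplex.exactAt_iff' _ _ _ (by simp; omega) (by simp; omega)).1 (hac _)
  · let e : X ≅ cokernel (R.complex.d 1 0) :=
      R.isColimitCokernelCofork.coconePointUniqueUpToIso (colimit.isColimit _)
    exact e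

end Coresolution

/-- If injective dimensions of projectives are bounded by `d`, the Gorenstein
projectives are exactly the objects admitting a projective coresolution. -/
theorem gp_iff_projective_coresolution {C : Type u} [Category.{v} C]
    [Abelian C] [EnoughProjectives C] [HasExt.{w} C] (d : ℕ)
    (hIG : ∀ P : C, Projective P → ∀ (Y : C) (j : ℕ), d < j →
      Subsingleton (Abelian.Ext Y P j)) :
    ∀ X : C, IsGorensteinProjective X ↔
      ∃ (Q : CochainComplex C ℕ) (ι : X ⟶ Q.X 0) (w : ι ≫ Q.d 0 1 = 0),
        (∀ i, Projective (Q.X i)) ∧ Mono ι ∧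
        (ShortComplex.mk ι (Q.d 0 1) w).Exact ∧
        ∀ i : ℕ, Q.ExactAt (i + 1) := by
  refine fun X => ⟨fun hX => hX.hasProjectiveCoresolution, fun hX => ?_⟩
  obtain ⟨P, hproj, hP, e⟩ := HasProjectiveCoresolution.exists_acyclic hX
  exact ⟨P, ⟨hproj, hP, fun R hR => exists_extension_of_exactAt hproj hP (hIG R hR)⟩, e⟩
end

section
/- Let C be an abelian category with enough projectives, and d∈ℕ. Then C is naively d-Gorenstein (every object has G-dimension at most d) if and only if C is weakly Gorenstein (gpC = ⊥pC) and every projective object has injective dimension at most d. -/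
open CategoryTheory CategoryTheory.Limits

universe w w' v v' u u'

section Aux

open Abelian

variable {C : Type u} [Category.{v} C] [Abelian C]

namespace IsSES

lemma mk' {X Y Z : C} (f : X ⟶ Y) (g : Y ⟶ Z) [Mono f] [Epi g] (w : f ≫ g = 0)
    (h : ∀ {T : C} (t : Y ⟶ T), f ≫ t = 0 → ∃ l, g ≫ l = t) : IsSES f g := by
  refine ⟨w, ?_⟩
  have : (ShortComplex.mk f g w).Exact := ShortComplex.exact_of_g_is_cokernel _
    (CokernelCofork.IsColimit.ofπ' _ _ fun t ht => ⟨(h t ht).choose, (h t ht).choose_spec⟩)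
  exact { exact := this }

variable {X Y Z : C} {f : X ⟶ Y} {g : Y ⟶ Z}

lemma mono (h : IsSES f g) : Mono f := h.choose_spec.mono_f

lemma epi (h : IsSES f g) : Epi g := h.choose_spec.epi_g

lemma zero (h : IsSES f g) : f ≫ g = 0 := h.choose

lemma exists_desc (h : IsSES f g) {T : C} (t : Y ⟶ T) (ht : f ≫ t = 0) :
    ∃ l, g ≫ l = t := by
  have := h.epi
  exact ⟨h.choose_spec.exact.desc t ht, h.choose_spec.exact.g_desc t ht⟩

lemma exists_lift (h : IsSES f g) {T : C} (t : T ⟶ Y) (ht : t ≫ g = 0) :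
    ∃ l, l ≫ f = t := by
  have := h.mono
  exact ⟨h.choose_spec.exact.lift t ht, h.choose_spec.exact.lift_f t ht⟩

lemma of_epi (g : Y ⟶ Z) [Epi g] : IsSES (kernel.ι g) g :=
  mk' _ _ (kernel.condition g) fun t ht =>
    ⟨Abelian.epiDesc g t ht, Abelian.comp_epiDesc g t ht⟩

lemma iso_comp {X' : C} (e : X' ≅ X) (h : IsSES f g) : IsSES (e.hom ≫ f) g := by
  have := h.mono
  have := h.epi
  refine mk' _ _ (by simp [h.zero]) fun t ht => h.exists_desc t ?_
  rw [← cancel_epi e.hom]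
  simpa using ht

/-- Pushing out a short exact sequence along a morphism. -/
lemma of_isPushout (hs : IsSES f g) {D E : C} {h : X ⟶ D} {a : Y ⟶ E} {b : D ⟶ E}
    (hp : IsPushout f h a b) : ∃ q : E ⟶ Z, a ≫ q = g ∧ IsSES b q := by
  have := hs.mono
  have := hs.epi
  have hb : Mono b := by
    have : b = pushout.inr f h ≫ hp.isoPushout.inv := by simp
    rw [this]
    infer_instance
  have ha := hp.inl_desc g (0 : D ⟶ Z) (by simp [hs.zero])
  have hq : Epi (hp.desc g (0 : D ⟶ Z) (by simp [hs.zero])) := by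
    have : Epi (a ≫ hp.desc g (0 : D ⟶ Z) (by simp [hs.zero])) := by rw [ha]; infer_instance
    exact epi_of_epi a _
  refine ⟨_, ha, mk' _ _ (by simp) fun t ht => ?_⟩
  obtain ⟨l, hl⟩ := hs.exists_desc (a ≫ t) (by rw [hp.w_assoc, ht, comp_zero])
  refine ⟨l, hp.hom_ext ?_ ?_⟩
  · rw [reassoc_of% ha, hl]
  · simp [ht]

/-- The pushout of two short exact sequences with the same left term. -/
lemma exists_pushout (hs : IsSES f g) {D F : C} {h : X ⟶ D} {k : D ⟶ F} (hs' : IsSES h k) :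
    ∃ (E : C) (b : D ⟶ E) (q : E ⟶ Z) (a : Y ⟶ E) (r : E ⟶ F), IsSES b q ∧ IsSES a r := by
  obtain ⟨q, -, hq⟩ := hs.of_isPushout (IsPushout.of_hasPushout f h)
  obtain ⟨r, -, hr⟩ := hs'.of_isPushout (IsPushout.of_hasPushout f h).flip
  exact ⟨_, _, q, _, r, hq, hr⟩

/-- The cokernel of a composition of monomorphisms is an extension of the cokernels. -/
lemma exists_comp (hs : IsSES f g) {V W : C} {a : Y ⟶ V} {b : V ⟶ W} (hs' : IsSES a b) :
    ∃ (U : C) (r : V ⟶ U) (i : Z ⟶ U) (p : U ⟶ W), IsSES (f ≫ a) r ∧ IsSES i p := by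
  have hp := IsPushout.of_hasPushout a g
  obtain ⟨q, -, hq⟩ := hs'.of_isPushout hp
  have := hs.mono
  have := hs.epi
  have := hs'.mono
  refine ⟨_, _, _, q, mk' _ (pushout.inl a g) ?_ fun t ht => ?_, hq⟩
  · rw [Category.assoc, hp.w, ← Category.assoc, hs.zero, zero_comp]
  · obtain ⟨u, hu⟩ := hs.exists_desc (a ≫ t) (by simpa using ht)
    exact ⟨hp.desc t u hu.symm, by simp⟩

/-- If a short exact sequence splits, a short exact sequence starting in its right term
may be added to its left term. -/
lemma biprod_lift (hs : IsSES f g) {r : Y ⟶ X} (hr : f ≫ r = 𝟙 X) {V W : C}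
    {a : Z ⟶ V} {b : V ⟶ W} (hs' : IsSES a b) :
    IsSES (biprod.lift r (g ≫ a)) (biprod.snd ≫ b : X ⊞ V ⟶ W) := by
  have := hs.mono
  have := hs.epi
  have := hs'.mono
  have := hs'.epi
  have : Mono (biprod.lift r (g ≫ a)) := by
    refine Preadditive.mono_of_cancel_zero _ fun x hx => ?_
    have h1 : x ≫ r = 0 := by simpa using hx =≫ biprod.fst
    have h2 : x ≫ g = 0 := by
      rw [← cancel_mono a]
      simpa using hx =≫ biprod.snd
    obtain ⟨y, rfl⟩ := hs.exists_lift x h2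
    rw [Category.assoc, hr, Category.comp_id] at h1
    simp [h1]
  have : Epi (biprod.snd ≫ b : X ⊞ V ⟶ W) := epi_comp _ _
  refine mk' _ _ (by simp [hs'.zero]) fun t ht => ?_
  rw [biprod.lift_eq, Preadditive.add_comp] at ht
  simp only [Category.assoc] at ht
  have h1 : biprod.inl ≫ t = 0 := by
    simpa [reassoc_of% hr, reassoc_of% hs.zero] using f ≫= ht
  have h2 : a ≫ biprod.inr ≫ t = 0 := by
    rw [h1, comp_zero, zero_add] at ht
    rw [← cancel_epi g]
    simpa using ht
  obtain ⟨l, hl⟩ := hs'.exists_desc _ h2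
  refine ⟨l, biprod.hom_ext' _ _ ?_ ?_⟩
  · simp [h1]
  · simp [hl]

end IsSES

lemma IsTotallyAcyclic.isSES {P : ChainComplex C ℤ} (hP : IsTotallyAcyclic P) (i : ℤ) :
    IsSES (cokernel.desc (P.d (i + 1 + 1) (i + 1)) (P.d (i + 1) i) (by simp))
      (cokernel.π (P.d (i + 1) i)) := by
  have hex := (P.exactAt_iff' (i + 1 + 1) (i + 1) i (by simp) (by simp)).1 (hP.acyclic (i + 1))
  have : Mono (cokernel.desc (P.d (i + 1 + 1) (i + 1)) (P.d (i + 1) i) (by simp)) :=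
    hex.mono_cokernelDesc
  refine IsSES.mk' _ _ ?_ fun t ht => ⟨cokernel.desc _ t ?_, cokernel.π_desc _ _ _⟩
  · rw [← cancel_epi (cokernel.π _)]
    simp
  · simpa using cokernel.π (P.d (i + 1 + 1) (i + 1)) ≫= ht

variable [HasExt.{w} C]

/-- The positive Ext groups from `X` into projective objects vanish. -/
def IsLeftOrthogonal (X : C) : Prop :=
  ∀ P : C, Projective P → ∀ j : ℕ, 0 < j → Subsingleton (Ext X P j)

lemma isLeftOrthogonal_of_projective (X : C) [Projective X] : IsLeftOrthogonal X := by
  intro P _ j hj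
  obtain ⟨j, rfl⟩ := Nat.exists_eq_add_of_lt hj
  rw [zero_add]
  exact Ext.subsingleton_of_projective _ _ _

namespace IsSES

variable {X Y Z : C} {f : X ⟶ Y} {g : Y ⟶ Z}

lemma ext_middle (h : IsSES f g) (Q : C) (n : ℕ) [Subsingleton (Ext X Q n)]
    [Subsingleton (Ext Z Q n)] : Subsingleton (Ext Y Q n) := by
  obtain ⟨w, h⟩ := h
  refine subsingleton_of_forall_eq 0 fun x => ?_
  obtain ⟨y, rfl⟩ := Ext.contravariant_sequence_exact₂ h Q x (Subsingleton.elim (α := Ext X Q n) _ _)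
  rw [Subsingleton.elim (α := Ext Z Q n) y 0, Ext.comp_zero]

lemma ext_left (h : IsSES f g) (Q : C) (n : ℕ) [Subsingleton (Ext Y Q n)]
    [Subsingleton (Ext Z Q (n + 1))] : Subsingleton (Ext X Q n) := by
  obtain ⟨w, h⟩ := h
  refine subsingleton_of_forall_eq 0 fun x => ?_
  obtain ⟨y, rfl⟩ := Ext.contravariant_sequence_exact₁ h Q x (add_comm 1 n)
    (Subsingleton.elim (α := Ext Z Q (n + 1)) _ _)
  rw [Subsingleton.elim (α := Ext Y Q n) y 0, Ext.comp_zero]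

lemma ext_right (h : IsSES f g) (Q : C) (n : ℕ) [Subsingleton (Ext X Q n)]
    [Subsingleton (Ext Y Q (n + 1))] : Subsingleton (Ext Z Q (n + 1)) := by
  obtain ⟨w, h⟩ := h
  refine subsingleton_of_forall_eq 0 fun x => ?_
  obtain ⟨y, rfl⟩ := Ext.contravariant_sequence_exact₃ h Q x
    (Subsingleton.elim (α := Ext Y Q (n + 1)) _ _) (add_comm 1 n)
  rw [Subsingleton.elim (α := Ext X Q n) y 0, Ext.comp_zero]

lemma ext_one_right (h : IsSES f g) (Q : C) (hQ : ∀ a : X ⟶ Q, ∃ b : Y ⟶ Q, f ≫ b = a)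
    [Subsingleton (Ext Y Q 1)] : Subsingleton (Ext Z Q 1) := by
  obtain ⟨w, h⟩ := h
  refine subsingleton_of_forall_eq 0 fun x => ?_
  obtain ⟨y, rfl⟩ := Ext.contravariant_sequence_exact₃ h Q x
    (Subsingleton.elim (α := Ext Y Q 1) _ _) (add_zero 1)
  obtain ⟨a, rfl⟩ := (Ext.mk₀_bijective _ _).2 y
  obtain ⟨b, rfl⟩ := hQ a
  rw [← Ext.mk₀_comp_mk₀]
  exact h.extClass_comp_assoc _

lemma exists_extension (h : IsSES f g) {Q : C} (a : X ⟶ Q) [Subsingleton (Ext Z Q 1)] :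
    ∃ b : Y ⟶ Q, f ≫ b = a := by
  obtain ⟨w, h⟩ := h
  obtain ⟨y, hy⟩ := Ext.contravariant_sequence_exact₁ h Q (Ext.mk₀ a) (add_zero 1)
    (Subsingleton.elim (α := Ext Z Q 1) _ _)
  obtain ⟨b, rfl⟩ := (Ext.mk₀_bijective _ _).2 y
  rw [Ext.mk₀_comp_mk₀] at hy
  exact ⟨b, (Ext.mk₀_bijective _ _).1 hy⟩

lemma isLeftOrthogonal_middle (h : IsSES f g) (hX : IsLeftOrthogonal X)
    (hZ : IsLeftOrthogonal Z) : IsLeftOrthogonal Y := fun Q hQ j hj =>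
  have := hX Q hQ j hj
  have := hZ Q hQ j hj
  h.ext_middle Q j

lemma isLeftOrthogonal_left (h : IsSES f g) (hY : IsLeftOrthogonal Y)
    (hZ : IsLeftOrthogonal Z) : IsLeftOrthogonal X := fun Q hQ j hj =>
  have := hY Q hQ j hj
  have := hZ Q hQ (j + 1) (by lia)
  h.ext_left Q j

end IsSES

lemma IsTotallyAcyclic.isLeftOrthogonal {P : ChainComplex C ℤ} (hP : IsTotallyAcyclic P) (i : ℤ) :
    IsLeftOrthogonal (cokernel (P.d (i + 1) i)) := by
  intro Q hQ j hj
  obtain ⟨j, rfl⟩ := Nat.exists_eq_add_of_lt hj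
  rw [zero_add]
  induction j generalizing i with
  | zero =>
    have := hP.projective i
    have : Subsingleton (Ext (P.X i) Q 1) := Ext.subsingleton_of_projective _ _ _
    refine (hP.isSES i).ext_one_right Q fun a => ?_
    obtain ⟨b, hb⟩ : ∃ b : P.X i ⟶ Q, P.d (i + 1) i ≫ b = cokernel.π _ ≫ a := by
      have h := hP.homExact Q hQ (i + 1) (cokernel.π (P.d (i + 1 + 1) (i + 1)) ≫ a) (by simp)
      rwa [add_sub_cancel_right] at h
    refine ⟨b, ?_⟩
    rw [← cancel_epi (cokernel.π _)]
    simpa using hb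
  | succ j ih =>
    have := hP.projective i
    have : Subsingleton (Ext (P.X i) Q (j + 1 + 1)) := Ext.subsingleton_of_projective _ _ _
    have := ih (i + 1) (by lia)
    exact (hP.isSES i).ext_right Q (j + 1)

/-- Splicing short exact sequences of left orthogonal objects with projective middle terms. -/
lemma isGorensteinProjective_of_isSES (Z P : ℤ → C) (i : ∀ n, Z (n + 1) ⟶ P n)
    (p : ∀ n, P n ⟶ Z n) (hP : ∀ n, Projective (P n)) (hs : ∀ n, IsSES (i n) (p n))
    (hZ : ∀ n, IsLeftOrthogonal (Z n)) : IsGorensteinProjective (Z 0) := by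
  have hi := fun n => (hs n).mono
  have hp := fun n => (hs n).epi
  let K : ChainComplex C ℤ := ChainComplex.of P (fun n => p (n + 1) ≫ i n) fun n => by
    simp [reassoc_of% (hs (n + 1)).zero]
  have hd : ∀ n, K.d (n + 1) n = p (n + 1) ≫ i n := fun n =>
    ChainComplex.of_d P (fun n => p (n + 1) ≫ i n) n
  have hsplice : ∀ n {T : C} (t : P n ⟶ T), K.d (n + 1) n ≫ t = 0 → ∃ l, p n ≫ l = t := by
    intro n T t ht
    refine (hs n).exists_desc t ?_
    rw [hd, Category.assoc] at ht
    rwa [← cancel_epi (p (n + 1)), comp_zero]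
  have hlift : ∀ n {A : C} (x : A ⟶ P (n + 1)), x ≫ p (n + 1) ≫ i n = 0 →
      ∃ (A' : C) (π : A' ⟶ A) (_ : Epi π) (y : A' ⟶ P (n + 1 + 1)),
        π ≫ x = y ≫ p (n + 1 + 1) ≫ i (n + 1) := by
    intro n A x hx
    obtain ⟨y, rfl⟩ := (hs (n + 1)).exists_lift x (by
      rw [← cancel_mono (i n), Category.assoc, hx, zero_comp])
    exact ⟨pullback y (p (n + 1 + 1)), pullback.fst _ _, inferInstance, pullback.snd _ _,
      by rw [pullback.condition_assoc]⟩
  refine ⟨K, ⟨hP, fun n => ?_, fun Q hQ n f hf => ?_⟩, ⟨?_⟩⟩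
  · obtain ⟨n, rfl⟩ : ∃ m, n = m + 1 := ⟨n - 1, by lia⟩
    rw [K.exactAt_iff' (n + 1 + 1) (n + 1) n (by simp) (by simp),
      ShortComplex.exact_iff_exact_up_to_refinements]
    intro A x hx
    have hx' : x ≫ K.d (n + 1) n = 0 := hx
    rw [hd] at hx'
    obtain ⟨A', π, hπ, y, hy⟩ := hlift n x hx'
    exact ⟨A', π, hπ, y, hy.trans (congrArg (y ≫ ·) (hd (n + 1)).symm)⟩
  · obtain ⟨m, rfl⟩ : ∃ m, n = m + 1 := ⟨n - 1, by lia⟩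
    obtain ⟨u, rfl⟩ := hsplice _ f hf
    have := hZ m Q hQ 1 one_pos
    obtain ⟨g, rfl⟩ := (hs m).exists_extension u
    rw [add_sub_cancel_right]
    exact ⟨g, by rw [hd, Category.assoc]⟩
  · have h0 : K.d 1 0 = p 1 ≫ i 0 := hd 0
    have w : K.d 1 0 ≫ p 0 = 0 := by
      rw [h0, Category.assoc, (hs 0).zero, comp_zero]
    have hc : IsColimit (CokernelCofork.ofπ (p 0) w) :=
      (CokernelCofork.IsColimit.ofπ' (p 0) w fun t ht =>
        ⟨(hsplice 0 t ht).choose, (hsplice 0 t ht).choose_spec⟩)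
    exact hc.coconePointUniqueUpToIso (colimit.isColimit (parallelPair (K.d 1 0) 0))

/-- A class of left orthogonal objects, each of which embeds into a projective object with
cokernel in the class, consists of Gorenstein projective objects. -/
lemma isGorensteinProjective_of_coresolving [EnoughProjectives C] (S : C → Prop)
    (hS : ∀ X, S X → IsLeftOrthogonal X)
    (hcos : ∀ X, S X → ∃ (P X' : C) (i : X ⟶ P) (p : P ⟶ X'),
      Projective P ∧ IsSES i p ∧ S X')
    {X : C} (hX : S X) : IsGorensteinProjective X := by
  have hcos' : ∀ x : {X : C // S X}, ∃ y : {X : C // S X}, ∃ (P : C) (i : x.1 ⟶ P)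
      (p : P ⟶ y.1), Projective P ∧ IsSES i p := fun x => by
    obtain ⟨P, X', i, p, hP, h, hX'⟩ := hcos x.1 x.2
    exact ⟨⟨X', hX'⟩, P, i, p, hP, h⟩
  have hsyz : ∀ x : {X : C // IsLeftOrthogonal X}, ∃ y : {X : C // IsLeftOrthogonal X},
      ∃ (P : C) (i : y.1 ⟶ P) (p : P ⟶ x.1), Projective P ∧ IsSES i p := fun x =>
    ⟨⟨kernel (Projective.π x.1), (IsSES.of_epi (Projective.π x.1)).isLeftOrthogonal_left
      (isLeftOrthogonal_of_projective _) x.2⟩, _, _, _, inferInstance,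
      IsSES.of_epi (Projective.π x.1)⟩
  choose cosyz hcosyz using hcos'
  choose syz hsyz using hsyz
  let a : ℕ → {X : C // IsLeftOrthogonal X} := fun n =>
    Nat.rec ⟨X, hS X hX⟩ (fun _ => syz) n
  let b : ℕ → {X : C // S X} := fun n => Nat.rec ⟨X, hX⟩ (fun _ => cosyz) n
  let Z : ℤ → C := fun n => Int.rec (fun n => (a n).1) (fun n => (b (n + 1)).1) n
  have hZ : ∀ n, IsLeftOrthogonal (Z n) := by
    rintro (n | n)
    · exact (a n).2
    · exact hS _ (b (n + 1)).2
  have hex : ∀ n, ∃ (P : C) (i : Z (n + 1) ⟶ P) (p : P ⟶ Z n), Projective P ∧ IsSES i p := by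
    rintro (n | n | n)
    · exact hsyz (a n)
    · exact hcosyz (b 0)
    · exact hcosyz (b (n + 1))
  choose P i p hP hs using hex
  exact isGorensteinProjective_of_isSES Z P i p hP hs hZ

lemma IsGorensteinProjective.isLeftOrthogonal {X : C} (hX : IsGorensteinProjective X) :
    IsLeftOrthogonal X := by
  obtain ⟨P, hP, ⟨e⟩⟩ := hX
  have h := (hP.isSES (-1)).iso_comp e
  have := hP.projective (-1)
  exact h.isLeftOrthogonal_left (isLeftOrthogonal_of_projective _) (hP.isLeftOrthogonal _)

lemma IsGorensteinProjective.exists_isSES [EnoughProjectives C] {X : C}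
    (hX : IsGorensteinProjective X) : ∃ (P X' : C) (i : X ⟶ P) (p : P ⟶ X'),
      Projective P ∧ IsSES i p ∧ IsGorensteinProjective X' := by
  have key : ∀ X : C, (∃ (P : ChainComplex C ℤ) (i : ℤ), IsTotallyAcyclic P ∧
      Nonempty (X ≅ cokernel (P.d (i + 1) i))) → ∃ (P X' : C) (i : X ⟶ P) (p : P ⟶ X'),
      Projective P ∧ IsSES i p ∧ IsLeftOrthogonal X' ∧ ∃ (P : ChainComplex C ℤ) (i : ℤ),
        IsTotallyAcyclic P ∧ Nonempty (X' ≅ cokernel (P.d (i + 1) i)) := by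
    rintro X ⟨P, i, hP, ⟨e⟩⟩
    obtain ⟨i, rfl⟩ : ∃ j, i = j + 1 := ⟨i - 1, by lia⟩
    exact ⟨_, _, _, _, hP.projective i, (hP.isSES i).iso_comp e, hP.isLeftOrthogonal i,
      P, i, hP, ⟨Iso.refl _⟩⟩
  obtain ⟨P, hP, e⟩ := hX
  obtain ⟨Q, X', i, p, hQ, h, -, hX'⟩ := key X ⟨P, 0, hP, e⟩
  refine ⟨Q, X', i, p, hQ, h, isGorensteinProjective_of_coresolving
    (fun X => ∃ (P : ChainComplex C ℤ) (i : ℤ), IsTotallyAcyclic P ∧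
      Nonempty (X ≅ cokernel (P.d (i + 1) i))) (fun Y hY => ?_) (fun Y hY => ?_) hX'⟩
  · obtain ⟨P, X', i, p, hP, h, hX', -⟩ := key Y hY
    exact h.isLeftOrthogonal_left (isLeftOrthogonal_of_projective _) hX'
  · obtain ⟨P, X', i, p, hP, h, -, hX'⟩ := key Y hY
    exact ⟨P, X', i, p, hP, h, hX'⟩

lemma IsSES.isGorensteinProjective_middle [EnoughProjectives C] {X Y Z : C} {f : X ⟶ Y}
    {g : Y ⟶ Z} (h : IsSES f g) (hX : IsGorensteinProjective X)
    (hZ : IsGorensteinProjective Z) : IsGorensteinProjective Y := by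
  refine isGorensteinProjective_of_coresolving (fun Y => ∃ (X Z : C) (f : X ⟶ Y) (g : Y ⟶ Z),
    IsSES f g ∧ IsGorensteinProjective X ∧ IsGorensteinProjective Z) ?_ ?_
    ⟨X, Z, f, g, h, hX, hZ⟩
  · rintro Y ⟨X, Z, f, g, h, hX, hZ⟩
    exact h.isLeftOrthogonal_middle hX.isLeftOrthogonal hZ.isLeftOrthogonal
  · rintro Y ⟨X, Z, f, g, h, hX, hZ⟩
    obtain ⟨P, X', i, p, hP, hi, hX'⟩ := hX.exists_isSES
    obtain ⟨Q, Z', j, q, hQ, hj, hZ'⟩ := hZ.exists_isSES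
    obtain ⟨E, b, b', a, a', hb, ha⟩ := h.exists_pushout hi
    have := hZ.isLeftOrthogonal P hP 1 one_pos
    obtain ⟨r, hr⟩ := hb.exists_extension (𝟙 P)
    obtain ⟨U, c, k, l, hc, hk⟩ := ha.exists_comp (hb.biprod_lift hr hj)
    exact ⟨_, _, _, _, inferInstance, hc, _, _, _, _, hk, hX', hZ'⟩

/-- An object of finite G-dimension embeds into an object of finite projective dimension with
Gorenstein projective cokernel. -/
lemma HasResDimLE.exists_isSES [EnoughProjectives C] {X : C} {n : ℕ}
    (h : HasResDimLE IsGorensteinProjective X n) : ∃ (Y G : C) (i : X ⟶ Y) (p : Y ⟶ G),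
      IsSES i p ∧ HasResDimLE Projective Y n ∧ IsGorensteinProjective G := by
  induction h with
  | of_mem hX n =>
    obtain ⟨P, X', i, p, hP, hi, hX'⟩ := hX.exists_isSES
    exact ⟨P, X', i, p, hi, .of_mem hP n, hX'⟩
  | step n f g hses hG _ ih =>
    obtain ⟨Y, H, i, p, hi, hY, hH⟩ := ih
    obtain ⟨E, b, b', a, a', hb, ha⟩ := hses.exists_pushout hi
    obtain ⟨P, E', j, q, hP, hj, hE'⟩ := (ha.isGorensteinProjective_middle hG hH).exists_isSES
    obtain ⟨U, c, k, l, hc, hk⟩ := hb.exists_comp hj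
    exact ⟨U, E', k, l, hk, .step n _ _ hc hP hY, hE'⟩

lemma IsLeftOrthogonal.projective_of_hasResDimLE {X : C} {n : ℕ} (hX : IsLeftOrthogonal X)
    (h : HasResDimLE Projective X n) : Projective X := by
  induction h with
  | of_mem hP n => exact hP
  | @step X K P n f g hses hP _ ih =>
    have hK := ih (hses.isLeftOrthogonal_left (isLeftOrthogonal_of_projective P) hX)
    have := hX K hK 1 one_pos
    obtain ⟨r, hr⟩ := hses.exists_extension (𝟙 K)
    obtain ⟨s, hs⟩ := hses.exists_desc (𝟙 P - r ≫ f) (by simp [reassoc_of% hr])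
    have := hses.epi
    refine Retract.projective ⟨s, g, ?_⟩
    rw [← cancel_epi g, reassoc_of% hs]
    simp [hses.zero]

lemma HasResDimLE.subsingleton_ext {X : C} {n : ℕ}
    (h : HasResDimLE IsGorensteinProjective X n) (P : C) [hP : Projective P] {j : ℕ}
    (hj : n < j) : Subsingleton (Ext X P j) := by
  induction h generalizing j with
  | of_mem hX n => exact hX.isLeftOrthogonal P hP j (by lia)
  | step n f g hses hG _ ih =>
    obtain ⟨j, rfl⟩ : ∃ k, j = k + 1 := ⟨j - 1, by lia⟩
    have := hG.isLeftOrthogonal P hP (j + 1) (by lia)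
    have := ih (j := j) (by lia)
    exact hses.ext_right P j

lemma hasResDimLE_isLeftOrthogonal [EnoughProjectives C] (X : C) (n : ℕ)
    (h : ∀ P : C, Projective P → ∀ j : ℕ, n < j → Subsingleton (Ext X P j)) :
    HasResDimLE IsLeftOrthogonal X n := by
  induction n generalizing X with
  | zero => exact .of_mem h 0
  | succ n ih =>
    have hs := IsSES.of_epi (Projective.π X)
    refine .step n _ _ hs (isLeftOrthogonal_of_projective _) (ih _ fun P hP j hj => ?_)
    have := h P hP (j + 1) (by lia)
    obtain ⟨j, rfl⟩ : ∃ k, j = k + 1 := ⟨j - 1, by lia⟩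
    have : Subsingleton (Ext (Projective.over X) P (j + 1)) := Ext.subsingleton_of_projective _ _ _
    exact hs.ext_left P (j + 1)

end Aux

/-- `C` is naively `d`-Gorenstein iff it is weakly Gorenstein and `d`-IG. -/
theorem naively_gorenstein_iff {C : Type u} [Category.{v} C] [Abelian C]
    [EnoughProjectives C] [HasExt.{w} C] (d : ℕ) :
    (∀ X : C, HasResDimLE IsGorensteinProjective X d) ↔
      ((∀ X : C, IsGorensteinProjective X ↔
          ∀ P : C, Projective P → ∀ j : ℕ, 0 < j →
            Subsingleton (Abelian.Ext X P j)) ∧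
       (∀ P : C, Projective P → ∀ (Y : C) (j : ℕ), d < j →
          Subsingleton (Abelian.Ext Y P j))) := by
  refine ⟨fun h => ⟨fun X => ⟨fun hX => hX.isLeftOrthogonal, fun hX => ?_⟩,
    fun P hP Y j hj => (h Y).subsingleton_ext P hj⟩, fun ⟨h, hd⟩ X => ?_⟩
  · refine isGorensteinProjective_of_coresolving IsLeftOrthogonal (fun _ hX => hX)
      (fun X hX => ?_) hX
    obtain ⟨Y, G, i, p, hi, hY, hG⟩ := (h X).exists_isSES
    exact ⟨Y, G, i, p, (hi.isLeftOrthogonal_middle hX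
      hG.isLeftOrthogonal).projective_of_hasResDimLE hY, hi, hG.isLeftOrthogonal⟩
  · have hS : IsGorensteinProjective = IsLeftOrthogonal (C := C) :=
      funext fun X => propext (h X)
    rw [hS]
    exact hasResDimLE_isLeftOrthogonal X d fun P hP j hj => hd P hP X j hj
end

section
/- Let C be an abelian category with enough projectives in which every projective object has injective dimension at most d. Then every object X of finite projective dimension has injective dimension at most d. Consequently, if in addition C has enough injectives and every injective has projective dimension at most d, then the finitary dimension of C (the supremum of all finite projective dimensions of objects) is at most d. -/
open CategoryTheory CategoryTheory.Limits

universe w w' v v' u u'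

namespace CategoryTheory

open Abelian

variable {C : Type u} [Category.{v} C] [Abelian C]

/-- If all projective objects have injective dimension `< d`, then so do all objects of
finite projective dimension. -/
lemma hasInjectiveDimensionLT_of_hasProjectiveDimensionLE [EnoughProjectives C] {d : ℕ}
    (h : ∀ P : C, Projective P → HasInjectiveDimensionLT P d) (n : ℕ) (X : C)
    (hX : HasProjectiveDimensionLE X n) : HasInjectiveDimensionLT X d := by
  induction n generalizing X with
  | zero => exact h X ((projective_iff_hasProjectiveDimensionLE_zero X).2 hX)
  | succ n ih =>
    let S := ShortComplex.mk (kernel.ι (Projective.π X)) (Projective.π X) (kernel.condition _)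
    have hS : S.ShortExact := { exact := ShortComplex.exact_kernel _ }
    have hP : Projective S.X₂ := Projective.projective_over X
    have hK := ih S.X₁ ((hS.hasProjectiveDimensionLT_X₃_iff n hP).1 hX)
    exact hS.hasInjectiveDimensionLT_X₃ d (h _ hP)
      (hasInjectiveDimensionLT_of_ge S.X₁ d (d + 1) d.le_succ)

/-- If all injective objects have projective dimension `< d`, then so do all objects of
finite injective dimension. -/
lemma hasProjectiveDimensionLT_of_hasInjectiveDimensionLE [EnoughInjectives C] {d : ℕ}
    (h : ∀ I : C, Injective I → HasProjectiveDimensionLT I d) (n : ℕ) (X : C)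
    (hX : HasInjectiveDimensionLE X n) : HasProjectiveDimensionLT X d := by
  induction n generalizing X with
  | zero => exact h X (injective_iff_hasInjectiveDimensionLT_one.2 hX)
  | succ n ih =>
    let S := ShortComplex.mk (Injective.ι X) (cokernel.π (Injective.ι X)) (cokernel.condition _)
    have hS : S.ShortExact := { exact := ShortComplex.exact_cokernel _ }
    have hI : Injective S.X₂ := Injective.injective_under X
    have hQ := ih S.X₃ ((hS.hasInjectiveDimensionLT_X₃_iff n hI).2 hX)
    exact hS.hasProjectiveDimensionLT_X₁ d (h _ hI)
      (hasProjectiveDimensionLT_of_ge S.X₃ d (d + 1) d.le_succ)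

variable [HasExt.{w} C]

lemma hasInjectiveDimensionLE_iff_subsingleton_ext (X : C) (n : ℕ) :
    HasInjectiveDimensionLE X n ↔ ∀ (Y : C) (j : ℕ), n < j → Subsingleton (Ext Y X j) :=
  ⟨fun _ Y j hj ↦ HasInjectiveDimensionLT.subsingleton X (n + 1) j hj Y,
    fun h ↦ .mk fun j hj Y e ↦ (h Y j hj).elim e 0⟩

lemma hasProjectiveDimensionLE_iff_subsingleton_ext (X : C) (n : ℕ) :
    HasProjectiveDimensionLE X n ↔ ∀ (Y : C) (j : ℕ), n < j → Subsingleton (Ext X Y j) :=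
  ⟨fun _ Y j hj ↦ HasProjectiveDimensionLT.subsingleton X (n + 1) j hj Y,
    fun h ↦ .mk fun j hj Y e ↦ (h Y j hj).elim e 0⟩

lemma exists_hasProjectiveDimensionLE_of_projDim_ne_top {X : C} (hX : projDim X ≠ ⊤) :
    ∃ n, HasProjectiveDimensionLE X n := by
  contrapose! hX
  refine sInf_eq_top.2 ?_
  rintro _ ⟨m, rfl, hm⟩
  exact absurd ((hasProjectiveDimensionLE_iff_subsingleton_ext X m).2 hm) (hX m)

end CategoryTheory

/-- If `C` is `d`-IG, objects of finite projective dimension have injective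
dimension at most `d`; if `C` is moreover `d`-GI, the finitary dimension is at
most `d`. -/
theorem finitary_dimension_bound {C : Type u} [Category.{v} C] [Abelian C]
    [EnoughProjectives C] [HasExt.{w} C] (d : ℕ)
    (hIG : ∀ P : C, Projective P → ∀ (Y : C) (j : ℕ), d < j →
      Subsingleton (Abelian.Ext Y P j)) :
    (∀ X : C, projDim X ≠ ⊤ → ∀ (Y : C) (j : ℕ), d < j →
      Subsingleton (Abelian.Ext Y X j)) ∧
    (EnoughInjectives C →
      (∀ I : C, Injective I → ∀ (Y : C) (j : ℕ), d < j →
        Subsingleton (Abelian.Ext I Y j)) →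
      ∀ X : C, projDim X ≠ ⊤ → projDim X ≤ (d : ℕ∞)) := by
  have injDim_le (X : C) (hX : projDim X ≠ ⊤) : HasInjectiveDimensionLE X d := by
    obtain ⟨n, hn⟩ := exists_hasProjectiveDimensionLE_of_projDim_ne_top hX
    exact hasInjectiveDimensionLT_of_hasProjectiveDimensionLE
      (fun P hP ↦ (hasInjectiveDimensionLE_iff_subsingleton_ext P d).2 (hIG P hP)) n X hn
  refine ⟨fun X hX ↦ (hasInjectiveDimensionLE_iff_subsingleton_ext X d).1 (injDim_le X hX),
    fun _ hGI X hX ↦ sInf_le ⟨d, rfl, ?_⟩⟩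
  exact (hasProjectiveDimensionLE_iff_subsingleton_ext X d).1
    (hasProjectiveDimensionLT_of_hasInjectiveDimensionLE
      (fun I hI ↦ (hasProjectiveDimensionLE_iff_subsingleton_ext I d).2 (hGI I hI))
      d X (injDim_le X hX))
end
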